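/- arXiv:2307.03026 — 7 statements merged into one kernel-verified Lean document; each statement's English description precedes it below -/
import Mathlib

section
/- Let h : [0,1] → ℝ with h(0) = h(1) = 0, let μ be a Borel probability measure on ℝ such that x ↦ h(μ([x,∞))) is Lebesgue integrable on ℝ, and let a > 0, c ∈ ℝ. Let ν be the pushforward of μ under the map y ↦ a·y + c. Then x ↦ h(ν([x,∞))) is Lebesgue integrable and Φ_h(ν) = a · Φ_h(μ); i.e., the Choquet regularizer is location invariant and positively scale homogeneous. -/
open MeasureTheory Set

/-- Location invariance and positive scale homogeneity of the Choquet regularizer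
`Φ_h(μ) = ∫ h(μ([x,∞))) dx`: if `ν` is the pushforward of `μ` under `y ↦ a y + c`
with `a > 0`, then `Φ_h(ν) = a Φ_h(μ)`. -/
theorem choquet_location_scale
    (h : ℝ → ℝ) (h0 : h 0 = 0) (h1 : h 1 = 0)
    (μ : Measure ℝ) [IsProbabilityMeasure μ]
    (hint : Integrable (fun x : ℝ => h ((μ (Ici x)).toReal)))
    (a c : ℝ) (ha : 0 < a) :
    Integrable (fun x : ℝ => h (((μ.map (fun y => a * y + c)) (Ici x)).toReal)) ∧
    (∫ x : ℝ, h (((μ.map (fun y => a * y + c)) (Ici x)).toReal))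
      = a * ∫ x : ℝ, h ((μ (Ici x)).toReal) := by
  have key : (fun x : ℝ => h (((μ.map (fun y => a * y + c)) (Ici x)).toReal)) =
      fun x : ℝ => h ((μ (Ici ((x - c) / a))).toReal) := by
    funext x
    have hpre : (fun y : ℝ => a * y + c) ⁻¹' Ici x = Ici ((x - c) / a) := by
      ext y
      simp only [mem_preimage, mem_Ici]
      rw [div_le_iff₀ ha, sub_le_iff_le_add, mul_comm a y]
    rw [Measure.map_apply (by fun_prop) measurableSet_Ici, hpre]
  rw [key]
  refine ⟨(hint.comp_div ha.ne').comp_sub_right c, ?_⟩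
  rw [integral_sub_right_eq_self (fun x : ℝ => h ((μ (Ici (x / a))).toReal)) c,
    Measure.integral_comp_div (fun x : ℝ => h ((μ (Ici x)).toReal)) a, abs_of_pos ha, smul_eq_mul]
end

section
/- Let h : [0,1] → ℝ be concave with h(0) = h(1) = 0, and let μ, ν be Borel probability measures on ℝ such that x ↦ h(μ([x,∞))), x ↦ h(ν([x,∞))), and x ↦ h((tμ + (1−t)ν)([x,∞))) are Lebesgue integrable, where t ∈ [0,1]. Then Φ_h(tμ + (1−t)ν) ≥ t·Φ_h(μ) + (1−t)·Φ_h(ν); i.e., the Choquet regularizer is a concave functional of the distribution. -/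
open MeasureTheory Set

/-- Concavity of the Choquet regularizer `Φ_h(μ) = ∫ h(μ([x,∞))) dx` as a functional of
the distribution: `Φ_h(tμ + (1-t)ν) ≥ t Φ_h(μ) + (1-t) Φ_h(ν)`. -/
theorem choquet_concave
    (h : ℝ → ℝ)
    (hconc : ConcaveOn ℝ (Icc (0:ℝ) 1) h)
    (h0 : h 0 = 0) (h1 : h 1 = 0)
    (μ ν : Measure ℝ) [IsProbabilityMeasure μ] [IsProbabilityMeasure ν]
    (t : ℝ) (ht0 : 0 ≤ t) (ht1 : t ≤ 1)
    (hμ : Integrable (fun x : ℝ => h ((μ (Ici x)).toReal)))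
    (hν : Integrable (fun x : ℝ => h ((ν (Ici x)).toReal)))
    (hmix : Integrable (fun x : ℝ =>
      h (((ENNReal.ofReal t • μ + ENNReal.ofReal (1 - t) • ν) (Ici x)).toReal))) :
    t * (∫ x : ℝ, h ((μ (Ici x)).toReal))
      + (1 - t) * (∫ x : ℝ, h ((ν (Ici x)).toReal))
      ≤ ∫ x : ℝ, h (((ENNReal.ofReal t • μ + ENNReal.ofReal (1 - t) • ν) (Ici x)).toReal) := by
  have toReal_mem_Icc (ρ : Measure ℝ) [IsProbabilityMeasure ρ] (x : ℝ) :
      (ρ (Ici x)).toReal ∈ Icc (0 : ℝ) 1 :=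
    ⟨ENNReal.toReal_nonneg, measureReal_le_one⟩
  have toReal_mix (x : ℝ) :
      ((ENNReal.ofReal t • μ + ENNReal.ofReal (1 - t) • ν) (Ici x)).toReal
        = t * (μ (Ici x)).toReal + (1 - t) * (ν (Ici x)).toReal := by
    simp only [Measure.add_apply, Measure.smul_apply, smul_eq_mul]
    rw [ENNReal.toReal_add (ENNReal.mul_ne_top ENNReal.ofReal_ne_top (measure_ne_top _ _))
        (ENNReal.mul_ne_top ENNReal.ofReal_ne_top (measure_ne_top _ _)),
      ENNReal.toReal_mul, ENNReal.toReal_mul, ENNReal.toReal_ofReal ht0,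
      ENNReal.toReal_ofReal (sub_nonneg.2 ht1)]
  rw [← integral_const_mul, ← integral_const_mul,
    ← integral_add (hμ.const_mul t) (hν.const_mul (1 - t))]
  refine integral_mono ((hμ.const_mul t).add (hν.const_mul (1 - t))) hmix fun x => ?_
  simp only [toReal_mix]
  exact hconc.2 (toReal_mem_Icc μ x) (toReal_mem_Icc ν x) ht0 (sub_nonneg.2 ht1)
    (add_sub_cancel t 1)
end

section
/- Let h : [0,1] → ℝ be concave with h(0) = h(1) = 0, let t ∈ [0,1], and let μ, ν be Borel probability measures on ℝ such that x ↦ h(μ([x,∞))), x ↦ h(ν([x,∞))), and x ↦ h((tμ + (1−t)ν)([x,∞))) are Lebesgue integrable, and such that Φ_h(μ) > 0 and Φ_h(ν) > 0. Then log Φ_h(tμ + (1−t)ν) ≥ t·log Φ_h(μ) + (1−t)·log Φ_h(ν); i.e., the logarithmic Choquet regularizer log Φ_h is a concave functional of the distribution. -/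
open MeasureTheory Set

/-- Concavity of the logarithmic Choquet regularizer `log Φ_h` as a functional of the
distribution: if `Φ_h(μ) > 0` and `Φ_h(ν) > 0` then
`log Φ_h(tμ + (1-t)ν) ≥ t log Φ_h(μ) + (1-t) log Φ_h(ν)`. -/
theorem log_choquet_concave
    (h : ℝ → ℝ)
    (hconc : ConcaveOn ℝ (Icc (0:ℝ) 1) h)
    (h0 : h 0 = 0) (h1 : h 1 = 0)
    (t : ℝ) (ht0 : 0 ≤ t) (ht1 : t ≤ 1)
    (μ ν : Measure ℝ) [IsProbabilityMeasure μ] [IsProbabilityMeasure ν]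
    (hμ : Integrable (fun x : ℝ => h ((μ (Ici x)).toReal)))
    (hν : Integrable (fun x : ℝ => h ((ν (Ici x)).toReal)))
    (hmix : Integrable (fun x : ℝ =>
      h (((ENNReal.ofReal t • μ + ENNReal.ofReal (1 - t) • ν) (Ici x)).toReal)))
    (hμpos : 0 < ∫ x : ℝ, h ((μ (Ici x)).toReal))
    (hνpos : 0 < ∫ x : ℝ, h ((ν (Ici x)).toReal)) :
    t * Real.log (∫ x : ℝ, h ((μ (Ici x)).toReal))
      + (1 - t) * Real.log (∫ x : ℝ, h ((ν (Ici x)).toReal))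
      ≤ Real.log (∫ x : ℝ,
          h (((ENNReal.ofReal t • μ + ENNReal.ofReal (1 - t) • ν) (Ici x)).toReal)) := by
  have mem_unit (ρ : Measure ℝ) [IsProbabilityMeasure ρ] (x : ℝ) :
      (ρ (Ici x)).toReal ∈ Icc (0:ℝ) 1 :=
    ⟨ENNReal.toReal_nonneg, measureReal_le_one⟩
  have ht1' : 0 ≤ 1 - t := sub_nonneg.2 ht1
  have mix_apply (x : ℝ) :
      ((ENNReal.ofReal t • μ + ENNReal.ofReal (1 - t) • ν) (Ici x)).toReal
        = t * (μ (Ici x)).toReal + (1 - t) * (ν (Ici x)).toReal := by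
    rw [Measure.add_apply, Measure.smul_apply, Measure.smul_apply, smul_eq_mul, smul_eq_mul,
      ENNReal.toReal_add (by finiteness) (by finiteness), ENNReal.toReal_mul, ENNReal.toReal_mul,
      ENNReal.toReal_ofReal ht0, ENNReal.toReal_ofReal ht1']
  have integral_le : t * (∫ x : ℝ, h ((μ (Ici x)).toReal))
      + (1 - t) * (∫ x : ℝ, h ((ν (Ici x)).toReal))
      ≤ ∫ x : ℝ,
          h (((ENNReal.ofReal t • μ + ENNReal.ofReal (1 - t) • ν) (Ici x)).toReal) := by
    rw [← integral_const_mul, ← integral_const_mul,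
      ← integral_add (hμ.const_mul t) (hν.const_mul (1 - t))]
    refine integral_mono ((hμ.const_mul t).add (hν.const_mul (1 - t))) hmix fun x => ?_
    simp only [mix_apply]
    exact hconc.2 (mem_unit μ x) (mem_unit ν x) ht0 ht1' (add_sub_cancel t 1)
  have mean_pos : 0 < t * (∫ x : ℝ, h ((μ (Ici x)).toReal))
      + (1 - t) * (∫ x : ℝ, h ((ν (Ici x)).toReal)) :=
    convex_Ioi (0:ℝ) hμpos hνpos ht0 ht1' (add_sub_cancel t 1)
  exact (strictConcaveOn_log_Ioi.concaveOn.2 hμpos hνpos ht0 ht1' (add_sub_cancel t 1)).trans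
    (Real.log_le_log mean_pos integral_le)
end

section
/- Let T > 0, ρ ≠ 0, σ > 0, λ > 0, k > 0 and w, z ∈ ℝ, and define V : ℝ × ℝ → ℝ by V(t,x) = (x−w)²·e^{−ρ²(T−t)} − (λ²k²/(4ρ²σ²))·(e^{ρ²(T−t)} − 1) − (w−z)². Then for all (t,x) ∈ [0,T] × ℝ: (i) the second spatial derivative satisfies V_xx(t,x) = 2e^{−ρ²(T−t)} > 0; (ii) V satisfies the partial differential equation V_t(t,x) − (ρ²/2)·V_x(t,x)²/V_xx(t,x) − λ²k²/(2σ²·V_xx(t,x)) = 0; and (iii) V satisfies the terminal condition V(T,x) = (x−w)² − (w−z)². (This is the analytic core of Theorem 3.2: the explicit value function of the Choquet-regularized exploratory mean–variance problem, with k = ‖h′‖₂, solves its HJB equation.) -/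
open Real

/-- Derivative of a shifted square with a linear coefficient and constant. -/
lemma hasDerivAt_sub_sq_mul_sub (w E C D x : ℝ) :
    HasDerivAt (fun y : ℝ => (y - w)^2 * E - C - D) (2 * (x - w) * E) x := by
  have h := (((((hasDerivAt_id' x).sub_const w).pow 2).mul_const E).sub_const C).sub_const D
  simpa using h

lemma deriv_sub_sq_mul_sub (w E C D : ℝ) :
    deriv (fun y : ℝ => (y - w)^2 * E - C - D) = fun y => 2 * (y - w) * E :=
  funext fun x => (hasDerivAt_sub_sq_mul_sub w E C D x).deriv

lemma deriv_deriv_sub_sq_mul_sub (w E C D x : ℝ) :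
    deriv (deriv (fun y : ℝ => (y - w)^2 * E - C - D)) x = 2 * E := by
  rw [deriv_sub_sq_mul_sub]
  simp

lemma hasDerivAt_exp_mul_sub (a T t : ℝ) :
    HasDerivAt (fun τ : ℝ => Real.exp (a * (T - τ))) (-a * Real.exp (a * (T - t))) t := by
  have h := (((hasDerivAt_id' t).const_sub T).const_mul a).exp
  convert h using 1
  ring

lemma deriv_mul_exp_sub_mul_exp (A a b C D T t : ℝ) :
    deriv (fun τ : ℝ => A * Real.exp (a * (T - τ)) - C * (Real.exp (b * (T - τ)) - 1) - D) t =
      A * (-a * Real.exp (a * (T - t))) - C * (-b * Real.exp (b * (T - t))) :=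
  ((((hasDerivAt_exp_mul_sub a T t).const_mul A).sub
    (((hasDerivAt_exp_mul_sub b T t).sub_const 1).const_mul C)).sub_const D).deriv

/-- Analytic core of Theorem 3.2: the explicit value function
`V(t,x) = (x−w)² e^{−ρ²(T−t)} − (λ²k²/(4ρ²σ²))(e^{ρ²(T−t)} − 1) − (w−z)²`
of the Choquet-regularized exploratory mean–variance problem has positive second
spatial derivative `V_xx = 2 e^{−ρ²(T−t)}`, solves the HJB equation
`V_t − (ρ²/2) V_x²/V_xx − λ²k²/(2σ² V_xx) = 0` on `[0,T] × ℝ`, and satisfies the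
terminal condition `V(T,x) = (x−w)² − (w−z)²`. -/
theorem emv_value_function_solves_hjb
    (T ρ σ lam k w z : ℝ) (hT : 0 < T) (hρ : ρ ≠ 0) (hσ : 0 < σ)
    (hlam : 0 < lam) (hk : 0 < k) :
    letI V : ℝ → ℝ → ℝ := fun t x =>
      (x - w)^2 * Real.exp (-ρ^2 * (T - t))
        - lam^2 * k^2 / (4 * ρ^2 * σ^2) * (Real.exp (ρ^2 * (T - t)) - 1)
        - (w - z)^2
    ∀ t ∈ Set.Icc (0:ℝ) T, ∀ x : ℝ,
      letI Vt : ℝ := deriv (fun τ => V τ x) t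
      letI Vx : ℝ := deriv (fun y => V t y) x
      letI Vxx : ℝ := deriv (deriv (fun y => V t y)) x
      (Vxx = 2 * Real.exp (-ρ^2 * (T - t)) ∧ 0 < Vxx) ∧
      (Vt - ρ^2 / 2 * Vx^2 / Vxx - lam^2 * k^2 / (2 * σ^2 * Vxx) = 0) ∧
      (V T x = (x - w)^2 - (w - z)^2) := by
  intro t _ x
  have hσ0 : σ ≠ 0 := hσ.ne'
  refine ⟨⟨deriv_deriv_sub_sq_mul_sub _ _ _ _ _, ?_⟩, ?_, ?_⟩
  · rw [deriv_deriv_sub_sq_mul_sub]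
    positivity
  · rw [deriv_deriv_sub_sq_mul_sub, deriv_sub_sq_mul_sub, deriv_mul_exp_sub_mul_exp]
    have hE : Real.exp (-ρ^2 * (T - t)) = (Real.exp (ρ^2 * (T - t)))⁻¹ := by
      rw [neg_mul, Real.exp_neg]
    rw [hE]
    have hne := (Real.exp_pos (ρ^2 * (T - t))).ne'
    generalize Real.exp (ρ^2 * (T - t)) = F at hne ⊢
    field_simp
    ring
  · simp
end

section
/- Let T > 0, ρ ≠ 0, σ > 0, λ > 0, k > 0 and w, z ∈ ℝ, and define V̂ : ℝ × ℝ → ℝ by V̂(t,x) = (x−w)²·e^{−ρ²(T−t)} + (λρ²/4)·(T² − t²) − (λ/2)·(ρ²T + log(λk²/(2eσ²)))·(T − t) − (w−z)². Then for all (t,x) ∈ [0,T] × ℝ: (i) V̂_xx(t,x) = 2e^{−ρ²(T−t)} > 0; (ii) V̂ satisfies the partial differential equation V̂_t(t,x) − (ρ²/2)·V̂_x(t,x)²/V̂_xx(t,x) + λ/2 − (λ/2)·log(λk²/(σ²·V̂_xx(t,x))) = 0; and (iii) V̂(T,x) = (x−w)² − (w−z)². (This is the analytic core of Theorem 4.1: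 the explicit value function of the exploratory mean–variance problem regularized by the logarithmic Choquet regularizer, with k = ‖h′‖₂, solves its HJB equation.) -/
open Real

theorem hasDerivAt_sub_sq_mul_add_const (a b w y : ℝ) :
    HasDerivAt (fun y => (y - w)^2 * a + b) (2 * (y - w) * a) y := by
  have h := ((((hasDerivAt_id y).sub_const w).pow 2).mul_const a).add_const b
  simpa using h

theorem hasDerivAt_exp_neg_mul_sub (a T t : ℝ) :
    HasDerivAt (fun τ => Real.exp (-a * (T - τ))) (a * Real.exp (-a * (T - t))) t := by
  have h := (((hasDerivAt_id t).const_sub T).const_mul (-a)).exp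
  refine h.congr_deriv ?_
  simp only [id_eq]
  ring

theorem hasDerivAt_discounted_sq_add_quadratic (a b c d q T t : ℝ) :
    HasDerivAt (fun τ => q * Real.exp (-a * (T - τ)) + b * (T^2 - τ^2) - c * (T - τ) - d)
      (a * q * Real.exp (-a * (T - t)) - 2 * b * t + c) t := by
  have h := ((((hasDerivAt_exp_neg_mul_sub a T t).const_mul q).add
    ((((hasDerivAt_id t).pow 2).const_sub (T^2)).const_mul b)).sub
    (((hasDerivAt_id t).const_sub T).const_mul c)).sub_const d
  refine h.congr_deriv ?_
  simp only [id_eq]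
  push_cast
  ring

theorem log_div_mul_exp_neg {m s : ℝ} (hm : 0 < m) (hs : 0 < s) (r : ℝ) :
    Real.log (m / (s * (2 * Real.exp (-r)))) =
      Real.log (m / (2 * Real.exp 1 * s)) + 1 + r := by
  have h : m / (s * (2 * Real.exp (-r))) =
      m / (2 * Real.exp 1 * s) * Real.exp (1 + r) := by
    rw [Real.exp_neg, Real.exp_add]
    field_simp
  rw [h, Real.log_mul (by positivity) (Real.exp_ne_zero _), Real.log_exp]
  ring

/-- Analytic core of Theorem 4.1: the explicit value function
`V̂(t,x) = (x−w)² e^{−ρ²(T−t)} + (λρ²/4)(T²−t²) − (λ/2)(ρ²T + log(λk²/(2eσ²)))(T−t) − (w−z)²`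
of the exploratory mean–variance problem regularized by the logarithmic Choquet
regularizer has positive second spatial derivative `V̂_xx = 2 e^{−ρ²(T−t)}`, solves the
HJB equation `V̂_t − (ρ²/2) V̂_x²/V̂_xx + λ/2 − (λ/2) log(λk²/(σ² V̂_xx)) = 0` on
`[0,T] × ℝ`, and satisfies the terminal condition `V̂(T,x) = (x−w)² − (w−z)²`. -/
theorem emv_log_value_function_solves_hjb
    (T ρ σ lam k w z : ℝ) (hT : 0 < T) (hρ : ρ ≠ 0) (hσ : 0 < σ)
    (hlam : 0 < lam) (hk : 0 < k) :
    letI V : ℝ → ℝ → ℝ := fun t x =>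
      (x - w)^2 * Real.exp (-ρ^2 * (T - t))
        + lam * ρ^2 / 4 * (T^2 - t^2)
        - lam / 2 * (ρ^2 * T + Real.log (lam * k^2 / (2 * Real.exp 1 * σ^2))) * (T - t)
        - (w - z)^2
    ∀ t ∈ Set.Icc (0:ℝ) T, ∀ x : ℝ,
      letI Vt : ℝ := deriv (fun τ => V τ x) t
      letI Vx : ℝ := deriv (fun y => V t y) x
      letI Vxx : ℝ := deriv (deriv (fun y => V t y)) x
      (Vxx = 2 * Real.exp (-ρ^2 * (T - t)) ∧ 0 < Vxx) ∧
      (Vt - ρ^2 / 2 * Vx^2 / Vxx + lam / 2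
          - lam / 2 * Real.log (lam * k^2 / (σ^2 * Vxx)) = 0) ∧
      (V T x = (x - w)^2 - (w - z)^2) := by
  intro t _ x
  have hVx : deriv (fun y => (y - w)^2 * Real.exp (-ρ^2 * (T - t))
        + lam * ρ^2 / 4 * (T^2 - t^2)
        - lam / 2 * (ρ^2 * T + Real.log (lam * k^2 / (2 * Real.exp 1 * σ^2))) * (T - t)
        - (w - z)^2) = fun y => 2 * (y - w) * Real.exp (-ρ^2 * (T - t)) := by
    funext y
    simp only [add_sub_assoc]
    exact (hasDerivAt_sub_sq_mul_add_const _ _ w y).deriv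
  have hVxx : deriv (fun y => 2 * (y - w) * Real.exp (-ρ^2 * (T - t))) x =
      2 * Real.exp (-ρ^2 * (T - t)) := by
    simp
  have hVt := (hasDerivAt_discounted_sq_add_quadratic (ρ^2) (lam * ρ^2 / 4)
    (lam / 2 * (ρ^2 * T + Real.log (lam * k^2 / (2 * Real.exp 1 * σ^2))))
    ((w - z)^2) ((x - w)^2) T t).deriv
  have hlog := log_div_mul_exp_neg (m := lam * k^2) (s := σ^2) (by positivity) (by positivity)
    (ρ^2 * (T - t))
  rw [← neg_mul] at hlog
  simp only [hVx, hVxx, hVt, hlog]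
  refine ⟨⟨trivial, by positivity⟩, ?_, by simp⟩
  field_simp
  ring
end

section
/- Let T > 0, ρ ∈ ℝ, σ > 0, λ > 0 and k > 0. Then (λρ²/4)·T² − (λ/2)·(ρ²T + log(λk²/(2eσ²)))·T + λ·∫₀^T (1/2)·log((λk²/(2σ²))·e^{ρ²(T−t)}) dt = λT/2. (This is Proposition 4.4 for the logarithmic Choquet regularizer: the exploration cost Ĉ^{u*,Π̂*}(0,x₀;w) = (V̂(0,x₀;w) + λE[∫₀^T log Φ_h(Π̂*_t)dt]) − V^{cl}(0,x₀;w) equals λT/2, independent of the model parameters and of h.) -/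
open Real

/-- Proposition 4.4 for the logarithmic Choquet regularizer: the exploration cost
`Ĉ = (V̂(0,x₀;w) + λ∫₀ᵀ log Φ_h(Π̂*_t) dt) − V^{cl}(0,x₀;w)` equals `λT/2`, using
`V̂(0,x₀;w) − V^{cl}(0,x₀;w) = (λρ²/4)T² − (λ/2)(ρ²T + log(λk²/(2eσ²)))T` and
`log Φ_h(Π̂*_t) = (1/2) log((λk²/(2σ²)) e^{ρ²(T−t)})` with `k = ‖h′‖₂`. -/
theorem exploration_cost_log_choquet
    (T ρ σ lam k : ℝ) (hT : 0 < T) (hσ : 0 < σ) (hlam : 0 < lam) (hk : 0 < k) :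
    lam * ρ^2 / 4 * T^2
        - lam / 2 * (ρ^2 * T + Real.log (lam * k^2 / (2 * Real.exp 1 * σ^2))) * T
        + lam * ∫ t in (0:ℝ)..T,
            (1/2) * Real.log (lam * k^2 / (2 * σ^2) * Real.exp (ρ^2 * (T - t)))
      = lam * T / 2 := by
  have hA : 0 < lam * k^2 / (2 * σ^2) := by positivity
  have hlog : Real.log (lam * k^2 / (2 * Real.exp 1 * σ^2))
      = Real.log (lam * k^2 / (2 * σ^2)) - 1 := by
    rw [show lam * k^2 / (2 * Real.exp 1 * σ^2) = lam * k^2 / (2 * σ^2) / Real.exp 1 by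
      field_simp, Real.log_div hA.ne' (Real.exp_ne_zero 1), Real.log_exp]
  have hint : (∫ t in (0:ℝ)..T,
      (1/2) * Real.log (lam * k^2 / (2 * σ^2) * Real.exp (ρ^2 * (T - t))))
      = Real.log (lam * k^2 / (2 * σ^2)) * T / 2 + ρ^2 * T^2 / 4 := by
    simp_rw [Real.log_mul hA.ne' (Real.exp_ne_zero _), Real.log_exp]
    generalize Real.log (lam * k^2 / (2 * σ^2)) = L
    rw [intervalIntegral.integral_eq_sub_of_hasDerivAt
      (f := fun t => L * t / 2 - ρ^2 * (T - t)^2 / 4)]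
    · ring
    · intro t _
      have hsq := ((hasDerivAt_id' t).const_sub T).pow 2
      refine ((((hasDerivAt_id' t).const_mul L).div_const 2).sub
        ((hsq.const_mul (ρ^2)).div_const 4)).congr_deriv ?_
      push_cast
      ring
    · exact Continuous.intervalIntegrable (by fun_prop) _ _
  rw [hlog, hint]
  ring
end

section
/- Let m ∈ ℝ and s > 0, and let μ be the pushforward, under the map p ↦ m + s·(−log(1 − p) − 1), of Lebesgue measure restricted to (0,1). Then for every u ∈ ℝ, μ((−∞, u]) = 1 − exp(−(u − m)/s − 1) if u ≥ m − s, and μ((−∞, u]) = 0 if u < m − s; moreover μ has mean m and variance s². (This identifies the optimal exploratory distribution for the cumulative-residual-entropy generator h(p) = −p·log p, whose right derivative satisfies h′(1−p) = −log(1−p) − 1 and ‖h′‖₂ = 1, as a shifted exponential distribution, as in Example 3.4(i).) -/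
open MeasureTheory Set

theorem map_shifted_neg_log_Iic (m s : ℝ) (hs : 0 < s) (u : ℝ) :
    Measure.map (fun p : ℝ => m + s * (-Real.log (1 - p) - 1))
        (volume.restrict (Ioo (0:ℝ) 1)) (Iic u) =
      ENNReal.ofReal (1 - Real.exp (-((u - m) / s) - 1)) := by
  rw [Measure.map_apply (by fun_prop) measurableSet_Iic,
    Measure.restrict_apply' measurableSet_Ioo]
  have hset : (fun p : ℝ => m + s * (-Real.log (1 - p) - 1)) ⁻¹' Iic u ∩ Ioo 0 1 =
      Ioc 0 (1 - Real.exp (-((u - m) / s) - 1)) := by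
    ext p
    have key (hp : p < 1) : m + s * (-Real.log (1 - p) - 1) ≤ u ↔
        p ≤ 1 - Real.exp (-((u - m) / s) - 1) := by
      rw [le_sub_comm, ← Real.le_log_iff_exp_le (sub_pos.2 hp), ← le_sub_iff_add_le',
        ← le_div_iff₀' hs]
      constructor <;> intro h <;> linarith
    simp only [mem_inter_iff, mem_preimage, mem_Iic, mem_Ioo, mem_Ioc]
    constructor
    · rintro ⟨h, hp0, hp1⟩
      exact ⟨hp0, (key hp1).1 h⟩
    · rintro ⟨hp0, h⟩
      have hp1 : p < 1 := by linarith [Real.exp_pos (-((u - m) / s) - 1)]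
      exact ⟨(key hp1).2 h, hp0, hp1⟩
  rw [hset, Real.volume_Ioc, sub_zero]

theorem integral_log_add_one_sq : ∫ q in (0:ℝ)..1, (Real.log q + 1) ^ 2 = 1 := by
  let F : ℝ → ℝ := fun q => 4 * (√q * Real.log √q) ^ 2 + q
  have hF : Continuous F := by
    have := Real.continuous_mul_log.comp Real.continuous_sqrt
    exact (continuous_const.mul (this.pow 2)).add continuous_id
  have hF_eq {q : ℝ} (hq : 0 < q) : F q = q * Real.log q ^ 2 + q := by
    simp only [F, mul_pow, Real.sq_sqrt hq.le, Real.log_sqrt hq.le]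
    ring
  have hderiv : ∀ q ∈ Ioo (0:ℝ) 1, HasDerivAt F ((Real.log q + 1) ^ 2) q := by
    intro q hq
    have h : HasDerivAt (fun q : ℝ => q * Real.log q ^ 2 + q) ((Real.log q + 1) ^ 2) q := by
      refine (((hasDerivAt_id q).mul ((Real.hasDerivAt_log hq.1.ne').pow 2)).add
        (hasDerivAt_id q)).congr_deriv ?_
      have := hq.1.ne'
      simp only [id, Pi.pow_apply]
      field_simp
      ring
    refine h.congr_of_eventuallyEq ?_
    filter_upwards [lt_mem_nhds hq.1] with x hx using hF_eq hx
  have hint : IntervalIntegrable (fun q => (Real.log q + 1) ^ 2) volume 0 1 :=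
    intervalIntegral.intervalIntegrable_deriv_of_nonneg hF.continuousOn
      (by simpa using hderiv) (fun _ _ => sq_nonneg _)
  rw [intervalIntegral.integral_eq_sub_of_hasDerivAt_of_le zero_le_one hF.continuousOn
    hderiv hint]
  simp [F]

theorem setIntegral_Ioo_one_sub (f : ℝ → ℝ) :
    ∫ p in Ioo (0:ℝ) 1, f (1 - p) = ∫ q in (0:ℝ)..1, f q := by
  rw [← integral_Ioc_eq_integral_Ioo, ← intervalIntegral.integral_of_le zero_le_one,
    intervalIntegral.integral_comp_sub_left]
  simp

/-- Example 3.4(i): the optimal exploratory distribution for the cumulative residual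
entropy generator `h(p) = −p log p` (quantile function `p ↦ m + s(−log(1−p) − 1)`) is
the shifted exponential distribution with CDF `u ↦ 1 − e^{−(u−m)/s − 1}` on
`[m − s, ∞)`, with mean `m` and variance `s²`. -/
theorem optimal_distribution_shifted_exponential
    (m s : ℝ) (hs : 0 < s) :
    letI μ : Measure ℝ :=
      Measure.map (fun p : ℝ => m + s * (-Real.log (1 - p) - 1))
        (volume.restrict (Ioo (0:ℝ) 1))
    (∀ u : ℝ,
      (m - s ≤ u → μ (Iic u) = ENNReal.ofReal (1 - Real.exp (-((u - m) / s) - 1))) ∧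
      (u < m - s → μ (Iic u) = 0)) ∧
    (∫ x, x ∂μ) = m ∧ (∫ x, (x - m)^2 ∂μ) = s^2 := by
  have hmeas : Measurable (fun p : ℝ => m + s * (-Real.log (1 - p) - 1)) := by fun_prop
  refine ⟨fun u => ⟨fun _ => map_shifted_neg_log_Iic m s hs u, fun hu => ?_⟩, ?_, ?_⟩
  · rw [map_shifted_neg_log_Iic m s hs u, ENNReal.ofReal_eq_zero, sub_nonpos,
      Real.one_le_exp_iff]
    have : (u - m) / s ≤ -1 := by
      rw [div_le_iff₀ hs]
      linarith
    linarith
  · rw [integral_map hmeas.aemeasurable (by fun_prop),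
      setIntegral_Ioo_one_sub (fun q => m + s * (-Real.log q - 1))]
    have hlog : IntervalIntegrable (fun q => -Real.log q) volume 0 1 :=
      intervalIntegral.intervalIntegrable_log'.neg
    have hlog' : IntervalIntegrable (fun q => -Real.log q - 1) volume 0 1 :=
      hlog.sub intervalIntegrable_const
    rw [intervalIntegral.integral_add intervalIntegrable_const (hlog'.const_mul s),
      intervalIntegral.integral_const_mul,
      intervalIntegral.integral_sub hlog intervalIntegrable_const,
      intervalIntegral.integral_neg, integral_log]
    simp
  · rw [integral_map hmeas.aemeasurable (by fun_prop),
      setIntegral_Ioo_one_sub (fun q => (m + s * (-Real.log q - 1) - m) ^ 2)]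
    calc ∫ q in (0:ℝ)..1, (m + s * (-Real.log q - 1) - m) ^ 2
        = ∫ q in (0:ℝ)..1, s ^ 2 * (Real.log q + 1) ^ 2 := by
          congr 1 with q
          ring
      _ = s ^ 2 := by
          rw [intervalIntegral.integral_const_mul, integral_log_add_one_sq, mul_one]
end
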